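/- arXiv:2605.24434 — 2 statements merged into one kernel-verified Lean document; each statement's English description precedes it below -/
import Mathlib

section
/- Let R_d(z,w) = (w − z²)³ / ((w + 8z²)(z − 1)(w + 8z² + 4w² + 5wz² − 14zw − 4z³)). Fix λ ∈ ℂ, λ ≠ 0, and for t ∈ ℂ define z(t) = −(λt − 1)(λt² + 12λt − 9) / (λt(3 + t)((8λ + 1)t − 5)) and w(t) = −(λt² + 12λt − 9)²(λt² + 4λt − 1) / (λ²t²(3 + t)²((8λ + 1)t − 5)(t + 4)). Then for every t ∈ ℂ such that t(3 + t)((8λ + 1)t − 5)(t + 4) ≠ 0 and (w(t) + 8z(t)²)(z(t) − 1)(w(t) + 8z(t)² + 4w(t)² + 5w(t)z(t)² − 14z(t)w(t) − 4z(t)³) ≠ 0, one has R_d(z(t), w(t)) = λ. (Thus t ↦ (z(t), w(t)) is a rational parametrization of the level curve {R_d = λ}.) -/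
/-- Type d dual billiards: rational parametrization of the level curve `{R_d = λ}` of
`R_d(z,w) = (w − z²)³ / ((w + 8z²)(z − 1)(w + 8z² + 4w² + 5wz² − 14zw − 4z³))`. -/
theorem stmt_12 (lam : ℂ) (hlam : lam ≠ 0)
    (z w : ℂ → ℂ)
    (hz : ∀ t : ℂ, z t = -((lam*t - 1) * (lam*t^2 + 12*lam*t - 9)) /
      (lam * t * (3 + t) * ((8*lam + 1)*t - 5)))
    (hw : ∀ t : ℂ, w t = -((lam*t^2 + 12*lam*t - 9)^2 * (lam*t^2 + 4*lam*t - 1)) /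
      (lam^2 * t^2 * (3 + t)^2 * ((8*lam + 1)*t - 5) * (t + 4)))
    (t : ℂ) (ht : t * (3 + t) * ((8*lam + 1)*t - 5) * (t + 4) ≠ 0)
    (hden : (w t + 8*z t^2) * (z t - 1) *
      (w t + 8*z t^2 + 4*w t^2 + 5*w t*z t^2 - 14*z t*w t - 4*z t^3) ≠ 0) :
    (w t - z t^2)^3 / ((w t + 8*z t^2) * (z t - 1) *
      (w t + 8*z t^2 + 4*w t^2 + 5*w t*z t^2 - 14*z t*w t - 4*z t^3)) = lam := by
  obtain ⟨⟨⟨h0, h3⟩, hS⟩, h4⟩ : ((t ≠ 0 ∧ 3 + t ≠ 0) ∧ (8*lam + 1)*t - 5 ≠ 0) ∧ t + 4 ≠ 0 := by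
    simpa only [mul_ne_zero_iff] using ht
  have hz' := hz t
  have hw' := hw t
  set x := z t
  set y := w t
  obtain ⟨S, hSdef⟩ : ∃ S, S = (8*lam + 1)*t - 5 := ⟨_, rfl⟩
  obtain ⟨P, hPdef⟩ : ∃ P, P = lam*t^2 + 12*lam*t - 9 := ⟨_, rfl⟩
  obtain ⟨N, hNdef⟩ : ∃ N, N = -((lam*t - 1) * P) - lam * t * (3 + t) * S := ⟨_, rfl⟩
  rw [← hSdef] at hS hz' hw'
  rw [← hPdef] at hz' hw'
  have hsub : y - x^2 = P^2 * N / (lam^2 * t^2 * (3 + t)^2 * S^2 * (t + 4)) := by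
    rw [hz', hw']
    field_simp
    rw [hNdef, hPdef, hSdef]
    ring
  have hadd : y + 8*x^2 = -(P^3 * (3 + t)) / (lam^2 * t^2 * (3 + t)^2 * S^2 * (t + 4)) := by
    rw [hz', hw']
    field_simp
    rw [hPdef, hSdef]
    ring
  have hone : x - 1 = N / (lam * t * (3 + t) * S) := by
    rw [hz', hNdef]
    field_simp
  have hcubic : y + 8*x^2 + 4*y^2 + 5*y*x^2 - 14*x*y - 4*x^3 =
      -(P^3 * N^2 * t * S) / (lam^2 * t^2 * (3 + t)^2 * S^2 * (t + 4))^2 := by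
    rw [hz', hw']
    field_simp
    rw [hNdef, hPdef, hSdef]
    ring
  rw [div_eq_iff hden, hcubic, hsub, hadd, hone]
  field_simp
end

section
/- Let U ⊆ ℂ² be open and g : U → ℂ be holomorphic with w = 2·g(z,w)·z − g(z,w)² for all (z,w) ∈ U (so g(z,w) is the abscissa of a tangency point of a tangent line to the parabola {w = z²} through (z,w)). Let f : ℂ → ℂ be holomorphic on a neighborhood of g(U). Define Φ : U → ℂ² by Φ(z,w) = (z*, 2·g(z,w)·z* − g(z,w)²), where u = z − g(z,w) and z* = g(z,w) − u/(1 + f(g(z,w))·u). Then at every point (z,w) ∈ U with z ≠ g(z,w) and 1 + f(g(z,w))·(z − g(z,w)) ≠ 0, the determinant of the complex derivative of Φ at (z,w) equals −((z* − g(z,w))/(z − g(z,w)))³. (Consequently Φ multiplies the 2-form (z − g)^{−3} dz ∧ dw by −1, which yields invariance of the canonical area form ω_par = (z(Q) − z(P))^{−3} p_M*(dz ∧ dw) under the dual billiard map.) -/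
/-- The determinant of an endomorphism of `R × R` in terms of the images of the basis vectors. -/
theorem LinearMap.det_prod_self {R : Type*} [CommRing R] (A : R × R →ₗ[R] R × R) :
    LinearMap.det A = (A (1, 0)).1 * (A (0, 1)).2 - (A (0, 1)).1 * (A (1, 0)).2 := by
  rw [← LinearMap.det_toMatrix (Module.Basis.finTwoProd R), Matrix.det_fin_two]
  simp [LinearMap.toMatrix_apply]

/-- The Jacobian determinant of the half of the dual billiard map keeping the tangency
point fixed equals `−((z* − z₀)/(z − z₀))³`, where `z₀ = g(z,w)` is the tangency abscissa.
This yields invariance of the canonical area form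
`ω_par = (z(Q) − z(P))^{−3} p_M^*(dz ∧ dw)` under the dual billiard map. -/
theorem stmt_18 (U : Set (ℂ × ℂ)) (hU : IsOpen U)
    (g : ℂ × ℂ → ℂ) (hg : DifferentiableOn ℂ g U)
    (htang : ∀ p ∈ U, p.2 = 2 * g p * p.1 - (g p) ^ 2)
    (f : ℂ → ℂ) (V : Set ℂ) (hV : IsOpen V) (hgV : g '' U ⊆ V)
    (hf : DifferentiableOn ℂ f V)
    (zs : ℂ × ℂ → ℂ)
    (hzs : ∀ p : ℂ × ℂ, zs p = g p - (p.1 - g p) / (1 + f (g p) * (p.1 - g p)))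
    (Φ : ℂ × ℂ → ℂ × ℂ)
    (hΦ : ∀ p : ℂ × ℂ, Φ p = (zs p, 2 * g p * zs p - (g p) ^ 2))
    (p : ℂ × ℂ) (hp : p ∈ U) (hne : p.1 ≠ g p)
    (hden : 1 + f (g p) * (p.1 - g p) ≠ 0) :
    (fderiv ℂ Φ p).det = -(((zs p - g p) / (p.1 - g p)) ^ 3) := by
  have hUp : U ∈ nhds p := hU.mem_nhds hp
  have hG : HasFDerivAt g (fderiv ℂ g p) p := (hg.differentiableAt hUp).hasFDerivAt
  have hF : HasDerivAt f (deriv f (g p)) (g p) :=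
    (hf.differentiableAt (hV.mem_nhds (hgV ⟨p, hp, rfl⟩))).hasDerivAt
  have hz : HasFDerivAt (fun q : ℂ × ℂ => q.1) (ContinuousLinearMap.fst ℂ ℂ ℂ) p :=
    hasFDerivAt_fst
  have hw : HasFDerivAt (fun q : ℂ × ℂ => q.2) (ContinuousLinearMap.snd ℂ ℂ ℂ) p :=
    hasFDerivAt_snd
  have htan := ((hG.const_mul 2).mul hz).sub (hG.pow 2)
  have hgw : fderiv ℂ g p (0, 1) * (2 * (p.1 - g p)) = 1 := by
    have key := congrArg (fun A : ℂ × ℂ →L[ℂ] ℂ => A (0, 1))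
      ((htan.congr_of_eventuallyEq (Filter.eventually_of_mem hUp htang)).unique hw)
    simp at key
    linear_combination key
  have hu := hz.sub hG
  have hd := ((hF.comp_hasFDerivAt p hG).mul hu).const_add 1
  have hzs' : HasFDerivAt zs _ p :=
    (hG.sub (hu.mul ((hasDerivAt_inv hden).comp_hasFDerivAt p hd))).congr_of_eventuallyEq
      (Filter.Eventually.of_forall hzs)
  obtain ⟨Z, hZ, hZv⟩ : ∃ Z : ℂ × ℂ →L[ℂ] ℂ, HasFDerivAt zs Z p ∧ ∃ b : ℂ, ∀ v,
      Z v = -(1 + f (g p) * (p.1 - g p))⁻¹ ^ 2 * v.1 + b * fderiv ℂ g p v := by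
    refine ⟨_, hzs', 1 + (deriv f (g p) * (p.1 - g p) ^ 2 + 1) *
      (1 + f (g p) * (p.1 - g p))⁻¹ ^ 2, fun v => ?_⟩
    simp
    field_simp
    ring
  obtain ⟨b, hb⟩ := hZv
  have hΦ' : HasFDerivAt Φ _ p :=
    (hZ.prodMk (((hG.const_mul 2).mul hZ).sub (hG.pow 2))).congr_of_eventuallyEq
      (Filter.Eventually.of_forall hΦ)
  have hu0 : p.1 - g p ≠ 0 := sub_ne_zero.mpr hne
  have hgw' : fderiv ℂ g p (0, 1) = (2 * (p.1 - g p))⁻¹ := eq_inv_of_mul_eq_one_left hgw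
  rw [hΦ'.fderiv, ContinuousLinearMap.det, LinearMap.det_prod_self]
  simp [hb, hgw']
  rw [hzs p]
  field_simp
  ring
end
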